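/- arXiv:1311.6671 — 2 statements merged into one kernel-verified Lean document; each statement's English description precedes it below -/
import Mathlib

section
/- Let C, K ⊆ R^n be convex bodies. Then vol_n(C − K) ≤ binom(2n, n) · vol_n(K) · N(C, K) ≤ 4^n · vol_n(K) · N(C, K). Moreover, if K is symmetric (K = −K), then vol_n(C − K) ≤ 2^n · vol_n(K) · N(C, K). -/
open MeasureTheory Pointwise

/-- The covering number `N(A, B)`: the minimum cardinality of a finite set `T` with
`A ⊆ T + B`. -/
noncomputable def coveringNumber {α : Type*} [AddCommGroup α] (A B : Set α) : ℕ :=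
  sInf {m : ℕ | ∃ T : Finset α, T.card = m ∧ A ⊆ ↑T + B}

open Set

theorem lintegral_pow_mul_one_sub_pow (n : ℕ) :
    ∫⁻ t in Ioc (0 : ℝ) 1, ENNReal.ofReal (((n : ℝ) + 1) * (1 - t) ^ n) *
      ENNReal.ofReal (t ^ (n + 1)) = ((Nat.choose (2 * (n + 1)) (n + 1) : ℕ) : ENNReal)⁻¹ := by
  have hβ : ProbabilityTheory.beta (n + 2) (n + 1) * (n + 1) =
      ((Nat.choose (2 * (n + 1)) (n + 1) : ℕ) : ℝ)⁻¹ := by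
    have e1 : Real.Gamma (n + 2) = (n + 1).factorial := by
      rw [← Real.Gamma_nat_eq_factorial]; push_cast; ring_nf
    have e2 : Real.Gamma (n + 2 + (n + 1)) = (2 * (n + 1)).factorial := by
      rw [← Real.Gamma_nat_eq_factorial]; push_cast; ring_nf
    rw [ProbabilityTheory.beta, e1, e2, Real.Gamma_nat_eq_factorial,
      Nat.cast_choose ℝ (by omega : n + 1 ≤ 2 * (n + 1)),
      show 2 * (n + 1) - (n + 1) = n + 1 by omega, inv_div, div_mul_eq_mul_div]
    congr 1
    simp only [Nat.factorial_succ n]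
    push_cast
    ring
  have hpos : 0 < ProbabilityTheory.beta (n + 2) (n + 1) :=
    ProbabilityTheory.beta_pos (by positivity) (by positivity)
  have hone := ProbabilityTheory.lintegral_betaPDF_eq_one (α := (n : ℝ) + 2) (β := (n : ℝ) + 1)
    (by positivity) (by positivity)
  rw [ProbabilityTheory.lintegral_betaPDF] at hone
  have hcongr : ∀ t ∈ Ioo (0 : ℝ) 1, ENNReal.ofReal (((n : ℝ) + 1) * (1 - t) ^ n) *
      ENNReal.ofReal (t ^ (n + 1)) = ENNReal.ofReal (ProbabilityTheory.beta (n + 2) (n + 1) *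
        (n + 1)) * ENNReal.ofReal (1 / ProbabilityTheory.beta (n + 2) (n + 1) *
          t ^ ((n : ℝ) + 2 - 1) * (1 - t) ^ ((n : ℝ) + 1 - 1)) := by
    intro t ht
    have ht' := sub_pos.2 ht.2
    rw [← ENNReal.ofReal_mul (by positivity), ← ENNReal.ofReal_mul (by positivity),
      show (n : ℝ) + 2 - 1 = (n + 1 : ℕ) by push_cast; ring, add_sub_cancel_right,
      Real.rpow_natCast, Real.rpow_natCast]
    congr 1
    field_simp
  rw [← restrict_Ioo_eq_restrict_Ioc, setLIntegral_congr_fun measurableSet_Ioo hcongr,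
    lintegral_const_mul' _ _ ENNReal.ofReal_ne_top, hone, mul_one, hβ,
    ENNReal.ofReal_inv_of_pos (by exact_mod_cast Nat.choose_pos (by omega)),
    ENNReal.ofReal_natCast]

theorem exists_card_eq_coveringNumber {E : Type*} [AddCommGroup E] [TopologicalSpace E]
    [IsTopologicalAddGroup E] {C K : Set E} (hC : IsCompact C) (hK : (interior K).Nonempty) :
    ∃ T : Finset E, T.card = coveringNumber C K ∧ C ⊆ ↑T + K := by
  refine Nat.sInf_mem (s := {m : ℕ | ∃ T : Finset E, T.card = m ∧ C ⊆ ↑T + K}) ?_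
  obtain ⟨k, hk⟩ := hK
  obtain ⟨T, hT⟩ := hC.elim_finite_subcover (fun x : E => x +ᵥ interior K)
    (fun x => isOpen_interior.vadd x) (fun c _ => by
      rw [mem_iUnion]
      exact ⟨c - k, k, hk, by simp⟩)
  refine ⟨T.card, T, rfl, fun c hc => ?_⟩
  obtain ⟨x, hx, y, hy, rfl⟩ : ∃ x ∈ T, c ∈ x +ᵥ interior K := by simpa using hT hc
  exact ⟨x, hx, y, interior_subset hy, rfl⟩

theorem measure_sub_le_of_subset_add {E : Type*} [AddCommGroup E] [MeasurableSpace E]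
    [MeasurableAdd E] (μ : Measure E) [μ.IsAddLeftInvariant] {C K : Set E} {T : Finset E}
    (h : C ⊆ ↑T + K) : μ (C - K) ≤ μ (K - K) * T.card := by
  calc μ (C - K) ≤ μ (⋃ t ∈ T, t +ᵥ (K - K)) := by
        refine measure_mono ?_
        rintro _ ⟨c, hc, k, hk, rfl⟩
        obtain ⟨t, ht, l, hl, rfl⟩ := h hc
        simp only [mem_iUnion]
        exact ⟨t, ht, l - k, sub_mem_sub hl hk, by simp [add_sub_assoc]⟩
    _ ≤ ∑ t ∈ T, μ (t +ᵥ (K - K)) := measure_biUnion_finset_le _ _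
    _ = μ (K - K) * T.card := by simp [measure_vadd, mul_comm]

theorem lintegral_measure_inter_vadd {E : Type*} [AddCommGroup E] [MeasurableSpace E]
    [MeasurableAdd₂ E] [MeasurableNeg E] (μ : Measure E) [SFinite μ] [μ.IsAddLeftInvariant]
    [μ.IsNegInvariant] {K : Set E} (hK : MeasurableSet K) :
    ∫⁻ x, μ (K ∩ (x +ᵥ K)) ∂μ = μ K * μ K := by
  have hS : MeasurableSet {p : E × E | p.2 ∈ K ∧ -p.1 + p.2 ∈ K} :=
    (measurable_snd hK).inter ((measurable_fst.neg.add measurable_snd) hK)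
  have h1 := Measure.prod_apply (μ := μ) (ν := μ) hS
  rw [Measure.prod_apply_symm hS] at h1
  have e1 : ∀ x, Prod.mk x ⁻¹' {p : E × E | p.2 ∈ K ∧ -p.1 + p.2 ∈ K} = K ∩ (x +ᵥ K) := by
    intro x; ext y; simp [mem_vadd_set_iff_neg_vadd_mem]
  have e2 : ∀ y, μ ((fun x => (x, y)) ⁻¹' {p : E × E | p.2 ∈ K ∧ -p.1 + p.2 ∈ K}) =
      K.indicator (fun _ => μ K) y := by
    intro y
    by_cases hy : y ∈ K
    · have : ((fun x => (x, y)) ⁻¹' {p : E × E | p.2 ∈ K ∧ -p.1 + p.2 ∈ K}) = y +ᵥ (-K) := by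
        ext x; simp [mem_vadd_set_iff_neg_vadd_mem, hy, add_comm]
      rw [this, measure_vadd, Measure.measure_neg]; simp [hy]
    · simp [hy]
  simp only [e1, e2] at h1
  rw [← h1, lintegral_indicator hK]; simp

/-- If `x ∈ t • (K - K)` then `K ∩ (x + K)` contains a translate of `(1 - t) • K`. -/
theorem Convex.one_sub_pow_mul_measure_le {E : Type*} [NormedAddCommGroup E] [NormedSpace ℝ E]
    [MeasurableSpace E] [BorelSpace E] [FiniteDimensional ℝ E] (μ : Measure E)
    [μ.IsAddHaarMeasure] {K : Set E} (hK : Convex ℝ K) {t : ℝ} (ht0 : 0 ≤ t) (ht1 : t ≤ 1)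
    {x : E} (hx : x ∈ t • (K - K)) :
    ENNReal.ofReal ((1 - t) ^ Module.finrank ℝ E) * μ K ≤ μ (K ∩ (x +ᵥ K)) := by
  obtain ⟨_, ⟨a, ha, b, hb, rfl⟩, rfl⟩ := hx
  have h : (t • a) +ᵥ ((1 - t) • K) ⊆ K ∩ ((t • (a - b)) +ᵥ K) := by
    rintro _ ⟨_, ⟨k, hk, rfl⟩, rfl⟩
    refine ⟨hK ha hk ht0 (by linarith) (by ring), ?_⟩
    refine ⟨t • b + (1 - t) • k, hK hb hk ht0 (by linarith) (by ring), ?_⟩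
    simp only [vadd_eq_add, smul_sub]
    abel
  have h2 := measure_mono (μ := μ) h
  rwa [measure_vadd, Measure.addHaar_smul, abs_of_nonneg (pow_nonneg (sub_nonneg.2 ht1) _)] at h2

theorem setLIntegral_Icc_one_sub_pow (m : ℕ) {s : ℝ} (hs : 0 ≤ s) :
    ∫⁻ t in Icc (1 - s) 1, ENNReal.ofReal (((m : ℝ) + 1) * (1 - t) ^ m) =
      ENNReal.ofReal (s ^ (m + 1)) := by
  rw [← ofReal_integral_eq_lintegral_ofReal]
  · rw [integral_Icc_eq_integral_Ioc, ← intervalIntegral.integral_of_le (by linarith),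
      intervalIntegral.integral_const_mul,
      intervalIntegral.integral_comp_sub_left (fun u => u ^ m), integral_pow]
    congr 1
    field_simp
    simp
  · exact (by fun_prop : Continuous _).continuousOn.integrableOn_Icc
  · refine (ae_restrict_iff' measurableSet_Icc).2 (Filter.Eventually.of_forall fun t ht => ?_)
    have := sub_nonneg.2 ht.2
    simp only [Pi.zero_apply]
    positivity

theorem setLIntegral_indicator_smul_sub_le {E : Type*} [NormedAddCommGroup E] [NormedSpace ℝ E]
    [MeasurableSpace E] [BorelSpace E] [FiniteDimensional ℝ E] (μ : Measure E)
    [μ.IsAddHaarMeasure] {K : Set E} (hK : Convex ℝ K) (h0 : μ K ≠ 0) (htop : μ K ≠ ⊤) {m : ℕ}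
    (hm : Module.finrank ℝ E = m + 1) (x : E) :
    μ K * ∫⁻ t in Ioc (0 : ℝ) 1, (ENNReal.ofReal (((m : ℝ) + 1) * (1 - t) ^ m) *
      {p : ℝ × E | p.1⁻¹ • p.2 ∈ K - K}.indicator 1 (t, x)) ≤ μ (K ∩ (x +ᵥ K)) := by
  set c : ℝ := (μ (K ∩ (x +ᵥ K)) / μ K).toReal with hc
  have hle : μ (K ∩ (x +ᵥ K)) ≤ μ K := measure_mono inter_subset_left
  have hdiv : μ (K ∩ (x +ᵥ K)) / μ K ≠ ⊤ := ENNReal.div_ne_top (ne_top_of_le_ne_top htop hle) h0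
  have hc0 : 0 ≤ c := ENNReal.toReal_nonneg
  set s : ℝ := c ^ ((m + 1 : ℕ) : ℝ)⁻¹ with hs
  have hs0 : 0 ≤ s := by positivity
  have hsc : s ^ (m + 1) = c := Real.rpow_inv_natCast_pow hc0 (by simp)
  have key : ∫⁻ t in Ioc (0 : ℝ) 1, (ENNReal.ofReal (((m : ℝ) + 1) * (1 - t) ^ m) *
      {p : ℝ × E | p.1⁻¹ • p.2 ∈ K - K}.indicator 1 (t, x)) ≤
      ∫⁻ t in Icc (1 - s) 1, ENNReal.ofReal (((m : ℝ) + 1) * (1 - t) ^ m) := by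
    rw [← lintegral_indicator measurableSet_Ioc, ← lintegral_indicator measurableSet_Icc]
    refine lintegral_mono fun t => ?_
    by_cases ht : t ∈ Ioc (0 : ℝ) 1
    · rw [indicator_of_mem ht]
      by_cases hx : t⁻¹ • x ∈ K - K
      · have hx' : x ∈ t • (K - K) := (mem_smul_set_iff_inv_smul_mem₀ ht.1.ne' _ _).2 hx
        have h := hK.one_sub_pow_mul_measure_le μ ht.1.le ht.2 hx'
        rw [← ENNReal.le_div_iff_mul_le (Or.inl h0) (Or.inl htop),
          ENNReal.ofReal_le_iff_le_toReal hdiv, ← hc, ← hsc, hm,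
          pow_le_pow_iff_left₀ (sub_nonneg.2 ht.2) hs0 (by simp)] at h
        rw [indicator_of_mem (show t ∈ Icc (1 - s) 1 from ⟨by linarith, ht.2⟩)]
        exact mul_le_of_le_one_right' (indicator_le_self' (by simp) _)
      · rw [indicator_of_notMem (by simpa using hx)]; simp
    · rw [indicator_of_notMem ht]; exact zero_le
  calc _ ≤ μ K * ENNReal.ofReal (s ^ (m + 1)) := by
        rw [← setLIntegral_Icc_one_sub_pow m hs0]; gcongr
    _ = μ (K ∩ (x +ᵥ K)) := by
        rw [hsc, hc, ENNReal.ofReal_toReal hdiv, ENNReal.mul_div_cancel h0 htop]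

/-- The **Rogers–Shephard inequality** for the difference body. -/
theorem measure_sub_self_le {E : Type*} [NormedAddCommGroup E] [NormedSpace ℝ E]
    [MeasurableSpace E] [BorelSpace E] [FiniteDimensional ℝ E] (μ : Measure E)
    [μ.IsAddHaarMeasure] {K : Set E} (hKc : IsCompact K) (hK : Convex ℝ K)
    (hKi : (interior K).Nonempty) :
    μ (K - K) ≤ (Nat.choose (2 * Module.finrank ℝ E) (Module.finrank ℝ E) : ENNReal) * μ K := by
  have : ProperSpace E := FiniteDimensional.proper ℝ E
  have h0 : μ K ≠ 0 := (Measure.measure_pos_of_nonempty_interior μ hKi).ne'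
  have htop : μ K ≠ ⊤ := hKc.measure_ne_top
  rcases hm : Module.finrank ℝ E with _ | m
  · have := Module.finrank_zero_iff.1 hm
    obtain ⟨k, hk⟩ := hKi
    simpa using measure_mono (μ := μ) fun y _ =>
      (Subsingleton.elim k y) ▸ interior_subset hk
  set D := K - K with hD
  have hDm : MeasurableSet D := by
    rw [hD, sub_eq_add_neg]
    exact (hKc.add hKc.neg).measurableSet
  have hF : MeasurableSet {p : ℝ × E | p.1⁻¹ • p.2 ∈ D} :=
    (measurable_fst.inv.smul measurable_snd) hDm
  have hw : Measurable fun t : ℝ => ENNReal.ofReal (((m : ℝ) + 1) * (1 - t) ^ m) := by fun_prop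
  have hslice : ∀ t ∈ Ioc (0 : ℝ) 1, ∫⁻ x, (ENNReal.ofReal (((m : ℝ) + 1) * (1 - t) ^ m) *
      {p : ℝ × E | p.1⁻¹ • p.2 ∈ D}.indicator 1 (t, x)) ∂μ =
      ENNReal.ofReal (((m : ℝ) + 1) * (1 - t) ^ m) * ENNReal.ofReal (t ^ (m + 1)) * μ D := by
    intro t ht
    have : ∀ x, {p : ℝ × E | p.1⁻¹ • p.2 ∈ D}.indicator (1 : ℝ × E → ENNReal) (t, x) =
        (t • D).indicator 1 x := fun x => by
      by_cases hx : t⁻¹ • x ∈ D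
      · rw [indicator_of_mem ((mem_smul_set_iff_inv_smul_mem₀ ht.1.ne' _ _).2 hx),
          indicator_of_mem (by simpa using hx)]
        rfl
      · rw [indicator_of_notMem (by simpa using hx),
          indicator_of_notMem (by rwa [mem_smul_set_iff_inv_smul_mem₀ ht.1.ne'])]
    rw [lintegral_congr fun x => congrArg _ (this x),
      lintegral_const_mul _ (measurable_one.indicator (hDm.const_smul₀ t)),
      lintegral_indicator_one (hDm.const_smul₀ t), Measure.addHaar_smul, hm,
      abs_of_nonneg (pow_nonneg ht.1.le _), mul_assoc]
  have h : μ K * ((Nat.choose (2 * (m + 1)) (m + 1) : ENNReal)⁻¹ * μ D) ≤ μ K * μ K := by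
    calc _ = μ K * ∫⁻ t in Ioc (0 : ℝ) 1, ∫⁻ x, (ENNReal.ofReal (((m : ℝ) + 1) * (1 - t) ^ m) *
            {p : ℝ × E | p.1⁻¹ • p.2 ∈ D}.indicator 1 (t, x)) ∂μ := by
          rw [setLIntegral_congr_fun measurableSet_Ioc hslice,
            lintegral_mul_const _ (by fun_prop), lintegral_pow_mul_one_sub_pow]
      _ = ∫⁻ x, (μ K * ∫⁻ t in Ioc (0 : ℝ) 1, (ENNReal.ofReal (((m : ℝ) + 1) * (1 - t) ^ m) *
            {p : ℝ × E | p.1⁻¹ • p.2 ∈ D}.indicator 1 (t, x))) ∂μ := by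
          rw [lintegral_lintegral_swap, lintegral_const_mul' _ _ htop]
          exact ((hw.comp measurable_fst).mul (measurable_one.indicator hF)).aemeasurable
      _ ≤ ∫⁻ x, μ (K ∩ (x +ᵥ K)) ∂μ :=
          lintegral_mono fun x => setLIntegral_indicator_smul_sub_le μ hK h0 htop hm x
      _ = μ K * μ K := lintegral_measure_inter_vadd μ hKc.measurableSet
  rw [ENNReal.mul_le_mul_iff_right h0 htop] at h
  have hpos : Nat.choose (2 * (m + 1)) (m + 1) ≠ 0 := (Nat.choose_pos (by omega)).ne'
  rwa [mul_comm, ← div_eq_mul_inv, ENNReal.div_le_iff (by simpa using hpos) (by simp),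
    mul_comm] at h

/-- For convex bodies `C, K ⊆ ℝⁿ`,
`vol(C - K) ≤ binom(2n, n) · vol(K) · N(C, K) ≤ 4ⁿ · vol(K) · N(C, K)`,
and if `K` is symmetric then `vol(C - K) ≤ 2ⁿ · vol(K) · N(C, K)`. -/
theorem stmt_1 (n : ℕ) (C K : Set (Fin n → ℝ))
    (hCcpt : IsCompact C) (hCconv : Convex ℝ C) (hCint : (interior C).Nonempty)
    (hKcpt : IsCompact K) (hKconv : Convex ℝ K) (hKint : (interior K).Nonempty) :
    volume (C - K) ≤ (Nat.choose (2 * n) n : ENNReal) * volume K * (coveringNumber C K : ENNReal)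
    ∧ (Nat.choose (2 * n) n : ENNReal) * volume K * (coveringNumber C K : ENNReal)
        ≤ 4 ^ n * volume K * (coveringNumber C K : ENNReal)
    ∧ (K = -K →
        volume (C - K) ≤ 2 ^ n * volume K * (coveringNumber C K : ENNReal)) := by
  obtain ⟨T, hcard, hT⟩ := exists_card_eq_coveringNumber hCcpt hKint
  have hcov := measure_sub_le_of_subset_add volume hT
  rw [hcard] at hcov
  refine ⟨hcov.trans ?_, ?_, fun hsymm => hcov.trans ?_⟩
  · have := measure_sub_self_le volume hKcpt hKconv hKint
    rw [Module.finrank_fin_fun] at this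
    gcongr
  · have : (Nat.choose (2 * n) n : ENNReal) ≤ 4 ^ n := by
      exact_mod_cast n.centralBinom_le_four_pow
    gcongr
  · have : K - K = (2 : ℝ) • K := by
      rw [sub_eq_add_neg, ← hsymm, ← one_add_one_eq_two,
        hKconv.add_smul zero_le_one zero_le_one, one_smul]
    rw [this, Measure.addHaar_smul, Module.finrank_fin_fun]
    simp [ENNReal.ofReal_pow]
end

section
/- Let A ⊆ R^n be a convex body. Then the function ν(x) = (vol_n(A[x]) / vol_n(A))^{1/n}, where A[x] = (A − x) ∩ (x − A), is concave on A: for all x, y ∈ A and α ∈ [0, 1], ν(αx + (1 − α)y) ≥ α·ν(x) + (1 − α)·ν(y). -/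
open MeasureTheory Pointwise

open scoped ENNReal

/-- The one-dimensional Brunn–Minkowski inequality for compact sets. -/
lemma Real.volume_add_volume_le_of_isCompact {A B C : Set ℝ} (hA : IsCompact A) (hB : IsCompact B)
    (hA' : A.Nonempty) (hB' : B.Nonempty) (hC : A + B ⊆ C) :
    volume A + volume B ≤ volume C := by
  obtain ⟨a, ha⟩ := hA.exists_isGreatest hA'
  obtain ⟨b, hb⟩ := hB.exists_isLeast hB'
  have hsub : (b +ᵥ A) ∪ (a +ᵥ B) ⊆ C := by
    rintro x (⟨y, hy, rfl⟩ | ⟨y, hy, rfl⟩)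
    · exact hC ⟨y, hy, b, hb.1, add_comm y b⟩
    · exact hC ⟨a, ha.1, y, hy, rfl⟩
  have hdisj : volume ((b +ᵥ A) ∩ (a +ᵥ B)) = 0 := by
    refine measure_mono_null (t := {a + b}) ?_ (measure_singleton _)
    rintro x ⟨⟨y, hy, rfl⟩, ⟨z, hz, hzy⟩⟩
    have h₁ := ha.2 hy
    have h₂ := hb.2 hz
    simp only [vadd_eq_add, Set.mem_singleton_iff] at hzy ⊢
    linarith
  calc volume A + volume B = volume (b +ᵥ A) + volume (a +ᵥ B) := by
        rw [measure_vadd, measure_vadd]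
    _ = volume ((b +ᵥ A) ∪ (a +ᵥ B)) := by
        rw [← measure_union_add_inter _ (hB.vadd a).measurableSet, hdisj, add_zero]
    _ ≤ volume C := measure_mono hsub

/-- The one-dimensional Brunn–Minkowski inequality for measurable sets. -/
lemma Real.volume_add_volume_le {A B C : Set ℝ} (hA : MeasurableSet A) (hB : MeasurableSet B)
    (hA' : A.Nonempty) (hB' : B.Nonempty) (hC : A + B ⊆ C) :
    volume A + volume B ≤ volume C := by
  obtain ⟨a, ha⟩ := hA'
  obtain ⟨b, hb⟩ := hB'
  rw [hA.measure_eq_iSup_isCompact, hB.measure_eq_iSup_isCompact]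
  simp only [iSup_and']
  refine ENNReal.biSup_add_biSup_le' ⟨∅, by simp⟩ ⟨∅, by simp⟩ ?_
  rintro K ⟨hKA, hK⟩ L ⟨hLB, hL⟩
  refine (add_le_add (measure_mono (Set.subset_insert a K))
    (measure_mono (Set.subset_insert b L))).trans ?_
  exact Real.volume_add_volume_le_of_isCompact (hK.insert a) (hL.insert b)
    (Set.insert_nonempty _ _) (Set.insert_nonempty _ _)
    ((Set.add_subset_add (Set.insert_subset ha hKA) (Set.insert_subset hb hLB)).trans hC)

lemma lintegral_eq_lintegral_measure_ofReal_lt {α : Type*} [MeasurableSpace α] (μ : Measure α)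
    {f : α → ℝ≥0∞} (hf : Measurable f) (hf' : ∀ x, f x ≠ ∞) :
    ∫⁻ x, f x ∂μ = ∫⁻ r in Set.Ioi (0 : ℝ), μ {x | ENNReal.ofReal r < f x} := by
  have h := lintegral_eq_lintegral_meas_lt μ (f := fun x => (f x).toReal)
    (Filter.Eventually.of_forall fun x => ENNReal.toReal_nonneg) hf.ennreal_toReal.aemeasurable
  simp only [ENNReal.ofReal_toReal (hf' _)] at h
  rw [h]
  refine setLIntegral_congr_fun measurableSet_Ioi fun r hr => ?_
  simp only [ENNReal.ofReal_lt_iff_lt_toReal (Set.mem_Ioi.1 hr).le (hf' _)]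

/-- The additive form of the one-dimensional Prékopa–Leindler inequality, for functions with
supremum one. -/
lemma ofReal_mul_lintegral_add_le_lintegral {s t : ℝ} (hs : 0 < s) (ht : 0 < t) (hst : s + t = 1)
    {f g h : ℝ → ℝ≥0∞} (hf : Measurable f) (hg : Measurable g) (hh : Measurable h)
    (hf1 : ⨆ x, f x = 1) (hg1 : ⨆ x, g x = 1)
    (hfgh : ∀ x y, f x ^ s * g y ^ t ≤ h (s • x + t • y)) :
    ENNReal.ofReal s * (∫⁻ x, f x) + ENNReal.ofReal t * (∫⁻ x, g x) ≤ ∫⁻ x, h x := by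
  have hfle : ∀ x, f x ≤ 1 := fun x => hf1 ▸ le_iSup f x
  have hgle : ∀ x, g x ≤ 1 := fun x => hg1 ▸ le_iSup g x
  have key : ∀ r : ℝ, 0 < r → ENNReal.ofReal s * volume {x | ENNReal.ofReal r < f x}
      + ENNReal.ofReal t * volume {x | ENNReal.ofReal r < g x}
      ≤ volume {x | ENNReal.ofReal r < min (h x) 1} := by
    intro r hr
    rcases le_or_gt 1 (ENNReal.ofReal r) with h1 | h1
    · simp [fun x => ((hfle x).trans h1).not_gt, fun x => ((hgle x).trans h1).not_gt]
    · have hscale : ∀ (c : ℝ), 0 < c → ∀ S : Set ℝ,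
          ENNReal.ofReal c * volume S = volume (c • S) := by
        intro c hc S
        rw [Measure.addHaar_smul]
        simp [abs_of_pos hc]
      have hlevel : ∀ {u : ℝ → ℝ≥0∞}, ⨆ x, u x = 1 → {x | ENNReal.ofReal r < u x}.Nonempty :=
        fun hu => lt_iSup_iff.1 (h1.trans_eq hu.symm)
      rw [hscale s hs, hscale t ht]
      refine Real.volume_add_volume_le
        ((measurableSet_lt measurable_const hf).const_smul₀ s)
        ((measurableSet_lt measurable_const hg).const_smul₀ t)
        (Set.Nonempty.smul_set (hlevel hf1))
        (Set.Nonempty.smul_set (hlevel hg1)) ?_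
      rintro _ ⟨_, ⟨x, hx, rfl⟩, _, ⟨y, hy, rfl⟩, rfl⟩
      refine lt_min (lt_of_lt_of_le ?_ (hfgh x y)) h1
      calc ENNReal.ofReal r = ENNReal.ofReal r ^ s * ENNReal.ofReal r ^ t := by
            rw [← ENNReal.rpow_add_of_nonneg _ _ hs.le ht.le, hst, ENNReal.rpow_one]
        _ < f x ^ s * g y ^ t :=
            ENNReal.mul_lt_mul (ENNReal.rpow_lt_rpow hx hs) (ENNReal.rpow_lt_rpow hy ht)
  have hne : ∀ {a : ℝ≥0∞}, a ≤ 1 → a ≠ ∞ := fun ha => (ha.trans_lt ENNReal.one_lt_top).ne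
  rw [lintegral_eq_lintegral_measure_ofReal_lt _ hf fun x => hne (hfle x),
    lintegral_eq_lintegral_measure_ofReal_lt _ hg fun x => hne (hgle x)]
  refine le_trans ?_ (lintegral_mono fun x => min_le_left (h x) 1)
  rw [lintegral_eq_lintegral_measure_ofReal_lt _ (hh.min measurable_const)
    fun x => hne (min_le_right _ _)]
  refine (add_le_add (lintegral_const_mul_le _ _) (lintegral_const_mul_le _ _)).trans ?_
  exact (le_lintegral_add _ _).trans (setLIntegral_mono' measurableSet_Ioi key)

lemma ENNReal.rpow_mul_rpow_le_add {s t : ℝ} (hs : 0 < s) (ht : 0 < t) (hst : s + t = 1)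
    (a b : ℝ≥0∞) : a ^ s * b ^ t ≤ ENNReal.ofReal s * a + ENNReal.ofReal t * b := by
  have hpq : (s⁻¹).HolderConjugate t⁻¹ :=
    Real.holderConjugate_iff.2 ⟨(one_lt_inv₀ hs).2 (by linarith), by simpa using hst⟩
  have h := ENNReal.young_inequality (a ^ s) (b ^ t) hpq
  rwa [ENNReal.rpow_rpow_inv hs.ne', ENNReal.rpow_rpow_inv ht.ne', ENNReal.ofReal_inv_of_pos hs,
    ENNReal.ofReal_inv_of_pos ht, div_eq_mul_inv, div_eq_mul_inv, inv_inv, inv_inv, mul_comm a,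
    mul_comm b] at h

/-- A measure on a real vector space satisfies the Prékopa–Leindler inequality. -/
def PrekopaLeindler {E : Type*} [AddCommGroup E] [Module ℝ E] [MeasurableSpace E]
    (μ : Measure E) : Prop :=
  ∀ ⦃s t : ℝ⦄, 0 < s → 0 < t → s + t = 1 → ∀ ⦃f g h : E → ℝ≥0∞⦄,
    Measurable f → Measurable g → Measurable h →
    (∀ x y, f x ^ s * g y ^ t ≤ h (s • x + t • y)) →
    (∫⁻ x, f x ∂μ) ^ s * (∫⁻ x, g x ∂μ) ^ t ≤ ∫⁻ x, h x ∂μ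

lemma lintegral_rpow_mul_lintegral_rpow_le_of_iSup_ne_top {s t : ℝ} (hs : 0 < s) (ht : 0 < t)
    (hst : s + t = 1) {f g h : ℝ → ℝ≥0∞} (hf : Measurable f) (hg : Measurable g)
    (hh : Measurable h) (hf1 : ⨆ x, f x ≠ ∞) (hg1 : ⨆ x, g x ≠ ∞)
    (hfgh : ∀ x y, f x ^ s * g y ^ t ≤ h (s • x + t • y)) :
    (∫⁻ x, f x) ^ s * (∫⁻ x, g x) ^ t ≤ ∫⁻ x, h x := by
  set F := ⨆ x, f x with hF
  set G := ⨆ x, g x with hG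
  rcases eq_or_ne F 0 with hF0 | hF0
  · have : ∀ x, f x = 0 := fun x => le_antisymm (hF0 ▸ le_iSup f x) zero_le
    simp [this, ENNReal.zero_rpow_of_pos hs]
  rcases eq_or_ne G 0 with hG0 | hG0
  · have : ∀ x, g x = 0 := fun x => le_antisymm (hG0 ▸ le_iSup g x) zero_le
    simp [this, ENNReal.zero_rpow_of_pos ht]
  have hFs0 : F ^ s ≠ 0 := by simp [ENNReal.rpow_eq_zero_iff, hF0, hf1]
  have hGt0 : G ^ t ≠ 0 := by simp [ENNReal.rpow_eq_zero_iff, hG0, hg1]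
  have hFs : F ^ s ≠ ∞ := ENNReal.rpow_ne_top_of_nonneg hs.le hf1
  have hGt : G ^ t ≠ ∞ := ENNReal.rpow_ne_top_of_nonneg ht.le hg1
  have hmul : ∀ a b : ℝ≥0∞, (F⁻¹ * a) ^ s * (G⁻¹ * b) ^ t
      = (F ^ s * G ^ t)⁻¹ * (a ^ s * b ^ t) := by
    intro a b
    rw [ENNReal.mul_rpow_of_nonneg _ _ hs.le, ENNReal.mul_rpow_of_nonneg _ _ ht.le,
      ENNReal.inv_rpow, ENNReal.inv_rpow, ENNReal.mul_inv (Or.inl hFs0) (Or.inl hFs)]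
    ring
  have key := ofReal_mul_lintegral_add_le_lintegral hs ht hst (hf.const_mul F⁻¹)
    (hg.const_mul G⁻¹) (hh.const_mul (F ^ s * G ^ t)⁻¹)
    (by rw [← ENNReal.mul_iSup, ENNReal.inv_mul_cancel hF0 hf1])
    (by rw [← ENNReal.mul_iSup, ENNReal.inv_mul_cancel hG0 hg1])
    (fun x y => by rw [hmul]; gcongr; exact hfgh x y)
  have := (ENNReal.rpow_mul_rpow_le_add hs ht hst _ _).trans key
  rw [lintegral_const_mul _ hf, lintegral_const_mul _ hg, lintegral_const_mul _ hh, hmul] at this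
  exact (ENNReal.mul_le_mul_iff_right (ENNReal.inv_ne_zero.2 (ENNReal.mul_ne_top hFs hGt))
    (ENNReal.inv_ne_top.2 (mul_ne_zero hFs0 hGt0))).1 this

lemma PrekopaLeindler.volume_real : PrekopaLeindler (volume : Measure ℝ) := by
  intro s t hs ht hst f g h hf hg hh hfgh
  rcases eq_or_ne (∫⁻ x, f x) 0 with hf0 | hf0
  · simp [hf0, ENNReal.zero_rpow_of_pos hs]
  rcases eq_or_ne (∫⁻ x, g x) 0 with hg0 | hg0
  · simp [hg0, ENNReal.zero_rpow_of_pos ht]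
  have hlim : ∀ {u : ℝ → ℝ≥0∞}, Measurable u → Filter.Tendsto (fun N : ℕ => ∫⁻ x, min (u x) N)
      Filter.atTop (nhds (∫⁻ x, u x)) := by
    intro u hu
    refine lintegral_tendsto_of_tendsto_of_monotone
      (fun N => (hu.min measurable_const).aemeasurable)
      (Filter.Eventually.of_forall fun x m n hmn => min_le_min_left _ (by exact_mod_cast hmn))
      (Filter.Eventually.of_forall fun x => ?_)
    simpa using (tendsto_const_nhds (x := u x)).min ENNReal.tendsto_nat_nhds_top
  have hpos : ∀ {a : ℝ≥0∞} {r : ℝ}, 0 < r → a ≠ 0 → a ^ r ≠ 0 := fun hr ha => by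
    simp [ENNReal.rpow_eq_zero_iff, ha, hr.not_gt]
  refine le_of_tendsto (ENNReal.Tendsto.mul
    ((ENNReal.continuous_rpow_const.tendsto _).comp (hlim hf)) (Or.inl (hpos hs hf0))
    ((ENNReal.continuous_rpow_const.tendsto _).comp (hlim hg)) (Or.inl (hpos ht hg0)))
    (Filter.Eventually.of_forall fun N => ?_)
  have hbd : ∀ u : ℝ → ℝ≥0∞, ⨆ x, min (u x) N ≠ ∞ := fun u =>
    ((iSup_le fun x => min_le_right _ _).trans_lt (ENNReal.natCast_lt_top N)).ne
  refine lintegral_rpow_mul_lintegral_rpow_le_of_iSup_ne_top hs ht hst (hf.min measurable_const)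
    (hg.min measurable_const) hh (hbd f) (hbd g) fun x y => le_trans ?_ (hfgh x y)
  gcongr <;> exact min_le_left _ _

lemma PrekopaLeindler.prod {E F : Type*} [AddCommGroup E] [Module ℝ E] [MeasurableSpace E]
    [AddCommGroup F] [Module ℝ F] [MeasurableSpace F] {μ : Measure E} {ν : Measure F} [SFinite ν]
    (hμ : PrekopaLeindler μ) (hν : PrekopaLeindler ν) : PrekopaLeindler (μ.prod ν) := by
  intro s t hs ht hst f g h hf hg hh hfgh
  rw [lintegral_prod _ hf.aemeasurable, lintegral_prod _ hg.aemeasurable,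
    lintegral_prod _ hh.aemeasurable]
  exact hμ hs ht hst hf.lintegral_prod_right' hg.lintegral_prod_right' hh.lintegral_prod_right'
    fun x x' => hν hs ht hst (hf.comp measurable_prodMk_left) (hg.comp measurable_prodMk_left)
      (hh.comp measurable_prodMk_left) fun y y' => hfgh (x, y) (x', y')

lemma PrekopaLeindler.of_measurePreserving {E F : Type*} [AddCommGroup E] [Module ℝ E]
    [MeasurableSpace E] [AddCommGroup F] [Module ℝ F] [MeasurableSpace F] {μ : Measure E}
    {ν : Measure F} (hμ : PrekopaLeindler μ) (e : E →ₗ[ℝ] F) (he : MeasurePreserving e μ ν) :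
    PrekopaLeindler ν := by
  intro s t hs ht hst f g h hf hg hh hfgh
  rw [← he.lintegral_comp hf, ← he.lintegral_comp hg, ← he.lintegral_comp hh]
  exact hμ hs ht hst (hf.comp he.measurable) (hg.comp he.measurable) (hh.comp he.measurable)
    fun x y => by simpa using hfgh (e x) (e y)

/-- The Prékopa–Leindler inequality. -/
lemma PrekopaLeindler.pi_volume (n : ℕ) : PrekopaLeindler (volume : Measure (Fin n → ℝ)) := by
  induction n with
  | zero =>
    intro s t hs ht hst f g h hf hg hh hfgh
    have h1 : (volume : Measure (Fin 0 → ℝ)) Set.univ = 1 := by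
      rw [volume_pi, Measure.pi_of_empty, measure_univ]
    simp only [lintegral_unique, h1, mul_one]
    convert hfgh default default
  | succ n ih =>
    refine (volume_real.prod ih).of_measurePreserving
      (Fin.consLinearEquiv ℝ fun _ : Fin (n + 1) => ℝ).toLinearMap ?_
    have h := (volume_preserving_piFinSuccAbove (fun _ : Fin (n + 1) => ℝ) 0).symm
    have he : ⇑(Fin.consLinearEquiv ℝ fun _ : Fin (n + 1) => ℝ).toLinearMap
        = (MeasurableEquiv.piFinSuccAbove (fun _ : Fin (n + 1) => ℝ) 0).symm := by
      funext x
      simp [MeasurableEquiv.piFinSuccAbove, Fin.insertNthEquiv]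
      rfl
    rw [he]
    exact h

/-- The dimension-free form of the Brunn–Minkowski inequality. -/
lemma volume_rpow_mul_volume_rpow_le {n : ℕ} {s t : ℝ} (hs : 0 < s) (ht : 0 < t) (hst : s + t = 1)
    {S T D : Set (Fin n → ℝ)} (hS : MeasurableSet S) (hT : MeasurableSet T) (hD : MeasurableSet D)
    (hSTD : s • S + t • T ⊆ D) : volume S ^ s * volume T ^ t ≤ volume D := by
  have h := PrekopaLeindler.pi_volume n hs ht hst (f := S.indicator 1) (g := T.indicator 1)
    (h := D.indicator 1) (measurable_one.indicator hS) (measurable_one.indicator hT)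
    (measurable_one.indicator hD) fun x y => ?_
  · simpa only [lintegral_indicator_one hS, lintegral_indicator_one hT,
      lintegral_indicator_one hD] using h
  by_cases hx : x ∈ S
  · by_cases hy : y ∈ T
    · have : s • x + t • y ∈ D :=
        hSTD (Set.add_mem_add (Set.smul_mem_smul_set hx) (Set.smul_mem_smul_set hy))
      simp [hx, hy, this]
    · simp [hy, ENNReal.zero_rpow_of_pos ht]
  · simp [hx, ENNReal.zero_rpow_of_pos hs]

lemma volume_toReal_smul_pi {n : ℕ} {c : ℝ} (hc : 0 ≤ c) (S : Set (Fin n → ℝ)) :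
    (volume (c • S)).toReal = c ^ n * (volume S).toReal := by
  rw [Measure.addHaar_smul, ENNReal.toReal_mul, ENNReal.toReal_ofReal (abs_nonneg _),
    Module.finrank_fin_fun, abs_of_nonneg (pow_nonneg hc n)]

/-- The Brunn–Minkowski inequality for weighted sums of compact sets. -/
lemma IsCompact.brunn_minkowski {n : ℕ} (hn : n ≠ 0) {s t : ℝ} (hs : 0 < s) (ht : 0 < t)
    {S T D : Set (Fin n → ℝ)} (hS : IsCompact S) (hT : IsCompact T) (hD : IsCompact D)
    (hS' : S.Nonempty) (hT' : T.Nonempty) (hSTD : s • S + t • T ⊆ D) :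
    s * (volume S).toReal ^ (n : ℝ)⁻¹ + t * (volume T).toReal ^ (n : ℝ)⁻¹
      ≤ (volume D).toReal ^ (n : ℝ)⁻¹ := by
  have hn' : (n : ℝ)⁻¹ ≠ 0 := by simpa using hn
  have hn0 : (0 : ℝ) < (n : ℝ)⁻¹ := by positivity
  have hroot : ∀ {c : ℝ} (S : Set (Fin n → ℝ)), 0 ≤ c →
      (volume (c • S)).toReal ^ (n : ℝ)⁻¹ = c * (volume S).toReal ^ (n : ℝ)⁻¹ := by
    intro c S hc
    rw [volume_toReal_smul_pi hc, Real.mul_rpow (by positivity) (by positivity),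
      Real.pow_rpow_inv_natCast hc hn]
  rcases eq_or_lt_of_le (ENNReal.toReal_nonneg (a := volume S)) with hS0 | hS0
  · obtain ⟨x, hx⟩ := hS'
    rw [← hS0, Real.zero_rpow hn', mul_zero, zero_add, ← hroot T ht.le,
      ← measure_vadd volume (s • x)]
    gcongr
    · exact hD.measure_ne_top
    · exact Set.image_subset_iff.2 fun y hy =>
        hSTD (Set.add_mem_add (Set.smul_mem_smul_set hx) hy)
  rcases eq_or_lt_of_le (ENNReal.toReal_nonneg (a := volume T)) with hT0 | hT0
  · obtain ⟨x, hx⟩ := hT'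
    rw [← hT0, Real.zero_rpow hn', mul_zero, add_zero, ← hroot S hs.le,
      ← measure_vadd volume (t • x)]
    gcongr
    · exact hD.measure_ne_top
    · refine Set.image_subset_iff.2 fun y hy => hSTD ?_
      change t • x + y ∈ _
      rw [add_comm (t • x)]
      exact Set.add_mem_add hy (Set.smul_mem_smul_set hx)
  set a := (volume S).toReal ^ (n : ℝ)⁻¹ with ha
  set b := (volume T).toReal ^ (n : ℝ)⁻¹ with hb
  have ha0 : 0 < a := by positivity
  have hb0 : 0 < b := by positivity
  set u := s * a + t * b with hu
  have hu0 : 0 < u := by positivity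
  have hnormed : ∀ {S : Set (Fin n → ℝ)}, 0 < (volume S).toReal →
      volume ((((volume S).toReal ^ (n : ℝ)⁻¹)⁻¹ : ℝ) • S) = 1 := by
    intro S hS
    rw [← ENNReal.toReal_eq_one_iff, volume_toReal_smul_pi (by positivity), inv_pow,
      Real.rpow_inv_natCast_pow hS.le hn, inv_mul_cancel₀ hS.ne']
  have h := volume_rpow_mul_volume_rpow_le (s := u⁻¹ * (s * a)) (t := u⁻¹ * (t * b))
    (S := a⁻¹ • S) (T := b⁻¹ • T) (D := u⁻¹ • D) (by positivity) (by positivity)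
    (by rw [← mul_add, ← hu, inv_mul_cancel₀ hu0.ne'])
    (hS.smul _).measurableSet (hT.smul _).measurableSet (hD.smul _).measurableSet ?_
  · rw [hnormed hS0, hnormed hT0, ENNReal.one_rpow, ENNReal.one_rpow, one_mul] at h
    have h1 : 1 ≤ (volume (u⁻¹ • D)).toReal := by
      simpa using ENNReal.toReal_mono (hD.smul u⁻¹).measure_ne_top h
    have h2 := Real.one_le_rpow h1 hn0.le
    rwa [hroot D (by positivity), inv_mul_eq_div, one_le_div hu0] at h2
  · rw [smul_smul, smul_smul, mul_assoc, mul_assoc, mul_assoc, mul_assoc,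
      mul_inv_cancel₀ ha0.ne', mul_inv_cancel₀ hb0.ne', mul_one, mul_one, mul_smul, mul_smul,
      ← smul_add]
    exact Set.smul_set_mono hSTD

/-- For a convex body `A ⊆ ℝⁿ`, the function
`ν(x) = (vol(A[x]) / vol(A))^{1/n}`, where `A[x] = (A − x) ∩ (x − A)`, is concave on `A`. -/
theorem stmt_18 (n : ℕ) (A : Set (Fin n → ℝ))
    (hAcpt : IsCompact A) (hAconv : Convex ℝ A) (hAint : (interior A).Nonempty) :
    ConcaveOn ℝ A (fun x =>
      ((volume ((A - {x}) ∩ ({x} - A))).toReal / (volume A).toReal) ^ ((n : ℝ)⁻¹)) := by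
  rcases eq_or_ne n 0 with rfl | hn
  · simpa using concaveOn_const 1 hAconv
  refine concaveOn_iff_forall_pos.2 ⟨hAconv, fun x hx y hy s t hs ht hst => ?_⟩
  have hcpt : ∀ x, IsCompact ((A - {x}) ∩ ({x} - A)) := fun x =>
    (sub_eq_add_neg A {x} ▸ hAcpt.add isCompact_singleton.neg).inter
      (sub_eq_add_neg {x} A ▸ isCompact_singleton.add hAcpt.neg)
  have hne : ∀ x ∈ A, ((A - {x}) ∩ ({x} - A)).Nonempty := fun x hx =>
    ⟨0, by simpa [sub_eq_zero] using hx⟩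
  have h := IsCompact.brunn_minkowski hn hs ht (hcpt x) (hcpt y) (hcpt (s • x + t • y))
    (hne x hx) (hne y hy) ?_
  · simp only [Real.div_rpow ENNReal.toReal_nonneg ENNReal.toReal_nonneg, smul_eq_mul,
      mul_div_assoc', ← add_div]
    gcongr
  · simp only [Set.sub_singleton, Set.singleton_sub]
    rintro _ ⟨_, ⟨_, ⟨⟨p, hp, rfl⟩, ⟨p', hp', hpp⟩⟩, rfl⟩,
      _, ⟨_, ⟨⟨q, hq, rfl⟩, ⟨q', hq', hqq⟩⟩, rfl⟩, rfl⟩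
    refine ⟨⟨s • p + t • q, hAconv hp hq hs.le ht.le hst, ?_⟩,
      ⟨s • p' + t • q', hAconv hp' hq' hs.le ht.le hst, ?_⟩⟩
    · simp only [smul_sub]; abel
    · simp only [← hpp, ← hqq, smul_sub]; abel
end
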